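/- Let d ≥ 1 and let (S_z, J_z, h_z), z ∈ [z_c−δ, z_c), be a critical family with constants M, K, ζ. Then there exist C > 0 and δ' ∈ (0, δ] such that for all z ∈ [z_c−δ', z_c) and all x ∈ ℝ^d, | |x|_z − ‖x‖₂ | ≤ C m_z^{ζ∧2} ‖x‖₂. -/

import Mathlib

open scoped BigOperators ENNReal Real Topology Pointwise
open MeasureTheory Matrix Filter

noncomputable section

namespace OZpaper

variable {d : ℕ}

/-- Dot product of a real vector with a lattice point. -/
def rdotZ (μ : Fin d → ℝ) (x : Fin d → ℤ) : ℝ := ∑ i, μ i * (x i : ℝ)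

/-- Dot product of two real vectors. -/
def rdot (μ x : Fin d → ℝ) : ℝ := ∑ i, μ i * x i

/-- Euclidean norm of a lattice point. -/
def enormZ (x : Fin d → ℤ) : ℝ := Real.sqrt (∑ i, ((x i : ℝ)) ^ 2)

/-- Euclidean norm of a real vector. -/
def enormR (x : Fin d → ℝ) : ℝ := Real.sqrt (∑ i, (x i) ^ 2)

/-- ℓ¹ norm of a real vector. -/
def l1R (x : Fin d → ℝ) : ℝ := ∑ i, |x i|

/-- ℓ∞ norm of a real vector. -/
def linftyR (x : Fin d → ℝ) : ℝ := ⨆ i, |x i|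

/-- The vector `t • e₁`. -/
def e1R (d : ℕ) (t : ℝ) : Fin d → ℝ := fun i => if (i : ℕ) = 0 then t else 0

/-- The lattice point `n • e₁`. -/
def e1Z (d : ℕ) (n : ℤ) : Fin d → ℤ := fun i => if (i : ℕ) = 0 then n else 0

/-- Cast of a lattice point to a real vector. -/
def toR (x : Fin d → ℤ) : Fin d → ℝ := fun i => (x i : ℝ)

/-- ℤ^d-symmetry: invariance under coordinate permutations and sign flips. -/
def ZdSymmetric (f : (Fin d → ℤ) → ℝ) : Prop :=
  (∀ (σ : Equiv.Perm (Fin d)) (x : Fin d → ℤ), f (fun i => x (σ i)) = f x) ∧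
  (∀ (ε : Fin d → Bool) (x : Fin d → ℤ), f (fun i => if ε i then -(x i) else x i) = f x)

/-- Tilted susceptibility `χ^{(μ)}`, valued in `ℝ≥0∞`. -/
def chi (S : (Fin d → ℤ) → ℝ) (μ : Fin d → ℝ) : ℝ≥0∞ :=
  ∑' x, ENNReal.ofReal (S x * Real.exp (rdotZ μ x))

/-- The set `Ω = {μ : χ^{(μ)} < ∞}`. -/
def Omega (S : (Fin d → ℤ) → ℝ) : Set (Fin d → ℝ) := {μ | chi S μ < ⊤}

/-- The mass `m_S`. -/
def mass (S : (Fin d → ℤ) → ℝ) : ℝ := sSup {t : ℝ | 0 ≤ t ∧ chi S (e1R d t) < ⊤}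

/-- Assumption Ω. -/
structure AssumptionOmega (S : (Fin d → ℤ) → ℝ) : Prop where
  nonneg : ∀ x, 0 ≤ S x
  symm : ZdSymmetric S
  open_Omega : IsOpen (Omega S)
  zero_mem : (0 : Fin d → ℝ) ∈ Omega S
  exists_not_mem : ∃ μ₁ : ℝ, 0 < μ₁ ∧ e1R d μ₁ ∉ Omega S

/-- Fourier transform `Q̂(k) = ∑_y Q(y) e^{-i k·y}`. -/
def fourierZ (Q : (Fin d → ℤ) → ℝ) (k : Fin d → ℝ) : ℂ :=
  ∑' y, (Q y : ℂ) * Complex.exp (-Complex.I * (rdotZ k y : ℂ))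

/-- ℓ^p norm of a function on ℤ^d, valued in `ℝ≥0∞`. -/
def lpNorm (f : (Fin d → ℤ) → ℝ) (p : ℝ) : ℝ≥0∞ :=
  (∑' y, ENNReal.ofReal (|f y| ^ p)) ^ (1 / p)

/-- The exponent `p_d`. -/
def pExp (d : ℕ) (ζ : ℝ) : ℝ := if d = 1 then 2 else (d : ℝ) / ((d : ℝ) - 2 + min ζ 2)

/-- The class 𝒬_{M,K,ζ} without the (d-1)-th moment bounds. -/
structure MemQweak (M K ζ : ℝ) (Q g : (Fin d → ℤ) → ℝ) : Prop where
  Q_l1 : lpNorm Q 1 ≤ ENNReal.ofReal M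
  Q_moment : lpNorm (fun y => enormZ y ^ (2 + ζ) * Q y) 1 ≤ ENNReal.ofReal M
  infrared : ∀ k : Fin d → ℝ, (∀ i, |k i| ≤ π) →
    K * enormR k ^ 2 ≤ (fourierZ Q 0 - fourierZ Q k).re
  g_l1 : lpNorm g 1 ≤ ENNReal.ofReal M
  g_zeta : lpNorm (fun y => enormZ y ^ ζ * g y) 1 ≤ ENNReal.ofReal M
  g_two : lpNorm (fun y => enormZ y ^ (2 : ℝ) * g y) (min (pExp d ζ) 2) ≤ ENNReal.ofReal M

/-- The class 𝒬_{M,K,ζ}. -/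
structure MemQ (M K ζ : ℝ) (Q g : (Fin d → ℤ) → ℝ) : Prop where
  Q_l1 : lpNorm Q 1 ≤ ENNReal.ofReal M
  Q_moment : lpNorm (fun y => enormZ y ^ (2 + ζ) * Q y) 1 ≤ ENNReal.ofReal M
  infrared : ∀ k : Fin d → ℝ, (∀ i, |k i| ≤ π) →
    K * enormR k ^ 2 ≤ (fourierZ Q 0 - fourierZ Q k).re
  g_l1 : lpNorm g 1 ≤ ENNReal.ofReal M
  g_zeta : lpNorm (fun y => enormZ y ^ ζ * g y) 1 ≤ ENNReal.ofReal M
  g_two : lpNorm (fun y => enormZ y ^ (2 : ℝ) * g y) (min (pExp d ζ) 2) ≤ ENNReal.ofReal M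
  Q_dm1 : 4 ≤ d →
    lpNorm (fun y => enormZ y ^ ((d : ℝ) - 1) * Q y) (min ((d : ℝ) / 3) 2) ≤ ENNReal.ofReal M
  g_dm1 : 4 ≤ d →
    lpNorm (fun y => enormZ y ^ ((d : ℝ) - 1) * g y) 2 ≤ ENNReal.ofReal M

/-- Convolution on ℤ^d. -/
def conv (f g : (Fin d → ℤ) → ℝ) (x : Fin d → ℤ) : ℝ := ∑' y, f (x - y) * g y

/-- Exponential tilt `f^{(μ)}`. -/
def tilt (f : (Fin d → ℤ) → ℝ) (μ : Fin d → ℝ) : (Fin d → ℤ) → ℝ :=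
  fun x => f x * Real.exp (rdotZ μ x)

/-- `∑_y f(y) e^{μ·y}`, i.e. `f̂^{(μ)}(0)`. -/
def tiltSum (f : (Fin d → ℤ) → ℝ) (μ : Fin d → ℝ) : ℝ := ∑' y, f y * Real.exp (rdotZ μ y)

/-- Assumption J. -/
structure AssumptionJ (S J h : (Fin d → ℤ) → ℝ) (M K ζ : ℝ) : Prop where
  M_pos : 0 < M
  K_pos : 0 < K
  zeta_pos : 0 < ζ
  J_symm : ZdSymmetric J
  h_symm : ZdSymmetric h
  J_summable : Summable fun x => |J x|
  h_summable : Summable fun x => |h x|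
  OZ_eq : ∀ x, S x = h x + conv J S x
  memQ : ∀ μ ∈ closure (Omega S), MemQ M K ζ (tilt J μ) (tilt h μ)
  hhat_pos : ∀ μ ∈ closure (Omega S), 0 < tiltSum h μ

/-- Assumption J, without the (d-1)-th moment bounds of the class 𝒬. -/
structure AssumptionJweak (S J h : (Fin d → ℤ) → ℝ) (M K ζ : ℝ) : Prop where
  M_pos : 0 < M
  K_pos : 0 < K
  zeta_pos : 0 < ζ
  J_symm : ZdSymmetric J
  h_symm : ZdSymmetric h
  J_summable : Summable fun x => |J x|
  h_summable : Summable fun x => |h x|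
  OZ_eq : ∀ x, S x = h x + conv J S x
  memQ : ∀ μ ∈ closure (Omega S), MemQweak M K ζ (tilt J μ) (tilt h μ)
  hhat_pos : ∀ μ ∈ closure (Omega S), 0 < tiltSum h μ

/-- `μ` is the optimal tilt `μ_x̂` for direction `x`. -/
def IsOptTilt (S : (Fin d → ℤ) → ℝ) (x μ : Fin d → ℝ) : Prop :=
  μ ∈ frontier (Omega S) ∧ ∀ ν ∈ closure (Omega S), rdot ν x ≤ rdot μ x

/-- The norm `|x|_S = (max_{μ ∈ Ω̄} μ·x)/m_S`. -/
def normS (S : (Fin d → ℤ) → ℝ) (x : Fin d → ℝ) : ℝ :=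
  sSup ((fun μ => rdot μ x) '' closure (Omega S)) / mass S

/-- The drift vector `η` of the tilted kernel. -/
def etaOf (J : (Fin d → ℤ) → ℝ) (μ : Fin d → ℝ) : Fin d → ℝ :=
  fun j => ∑' y, (y j : ℝ) * J y * Real.exp (rdotZ μ y)

/-- The covariance matrix `Λ` of the tilted kernel. -/
def LambdaOf (J : (Fin d → ℤ) → ℝ) (μ : Fin d → ℝ) : Matrix (Fin d) (Fin d) ℝ :=
  Matrix.of fun j l => ∑' y, (y j : ℝ) * (y l : ℝ) * J y * Real.exp (rdotZ μ y)

/-- The Brownian heat kernel `ρ_t(x; η, Λ)`. -/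
def heatKer (d : ℕ) (t : ℝ) (x η : Fin d → ℝ) (Λ : Matrix (Fin d) (Fin d) ℝ) : ℝ :=
  (1 / Real.sqrt Λ.det) * (1 / (2 * π * t) ^ ((d : ℝ) / 2)) *
    Real.exp (-(1 / (2 * t)) * rdot (x - t • η) (Λ⁻¹ *ᵥ (x - t • η)))

/-- The Brownian Green function `𝒞(x; η, Λ)`. -/
def greenC (d : ℕ) (x η : Fin d → ℝ) (Λ : Matrix (Fin d) (Fin d) ℝ) : ℝ :=
  ∫ t in Set.Ioi (0 : ℝ), heatKer d t x η Λ

/-- The massive continuum Green function `𝔾_a(x)`. -/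
def massiveG (d : ℕ) (a : ℝ) (x : Fin d → ℝ) : ℝ :=
  ∫ t in Set.Ioi (0 : ℝ),
    (1 / (2 * π * t) ^ ((d : ℝ) / 2)) * Real.exp (-enormR x ^ 2 / (2 * t)) *
      Real.exp (-(t * a ^ 2) / 2)

/-- The constant `A_φ = ∫_{ℝ^d} ‖y‖₂^φ 𝔾₁(y) dy`. -/
def Aconst (d : ℕ) (φ : ℝ) : ℝ := ∫ y : Fin d → ℝ, enormR y ^ φ * massiveG d 1 y

/-- The torus `[-π, π]^d`. -/
def torus (d : ℕ) : Set (Fin d → ℝ) := Set.univ.pi fun _ => Set.Icc (-π) π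

/-- The Fourier integral `I_t(x)`. -/
def It (Q g : (Fin d → ℤ) → ℝ) (t : ℝ) (x : Fin d → ℤ) : ℂ :=
  (((2 * π) ^ d : ℝ) : ℂ)⁻¹ *
    ∫ k in torus d, Complex.exp (Complex.I * (rdotZ k x : ℂ)) * fourierZ g k *
      Complex.exp (-(t : ℂ) * (fourierZ Q 0 - fourierZ Q k))

/-- The quantity `G_Q(x)`. -/
def GQ (Q g : (Fin d → ℤ) → ℝ) (x : Fin d → ℤ) : ℂ :=
  ∫ t in Set.Ioi (0 : ℝ), It Q g t x

/-- The Kronecker delta at the origin. -/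
def deltaZ (d : ℕ) : (Fin d → ℤ) → ℝ := fun x => if x = 0 then 1 else 0

/-- n-fold convolution power. -/
def convPow (D : (Fin d → ℤ) → ℝ) : ℕ → (Fin d → ℤ) → ℝ
  | 0 => deltaZ d
  | n + 1 => conv D (convPow D n)

/-- Random-walk Green function `S_z(x) = ∑_n z^n D^{*n}(x)`. -/
def rwG (D : (Fin d → ℤ) → ℝ) (z : ℝ) (x : Fin d → ℤ) : ℝ :=
  ∑' n : ℕ, z ^ n * convPow D n x

/-- `σ² = ∑_x ‖x‖₂² J(x)`. -/
def sigmaSq (J : (Fin d → ℤ) → ℝ) : ℝ := ∑' x, enormZ x ^ 2 * J x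

/-- Susceptibility `χ = ∑_x S(x)`. -/
def suscept (S : (Fin d → ℤ) → ℝ) : ℝ := ∑' x, S x

/-- `ĥ(0) = ∑_x h(x)`. -/
def h0 (h : (Fin d → ℤ) → ℝ) : ℝ := ∑' x, h x

/-- Correlation length of order φ. -/
def xiPhi (S : (Fin d → ℤ) → ℝ) (φ : ℝ) : ℝ :=
  ((∑' x, enormZ x ^ φ * S x) / suscept S) ^ (1 / φ)

/-- A critical family of OZ systems. -/
structure CriticalFamily (d : ℕ) (δ zc M K ζ : ℝ) (S J h : ℝ → (Fin d → ℤ) → ℝ) : Prop where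
  δ_pos : 0 < δ
  assumOmega : ∀ z ∈ Set.Ico (zc - δ) zc, AssumptionOmega (S z)
  assumJ : ∀ z ∈ Set.Ico (zc - δ) zc, AssumptionJ (S z) (J z) (h z) M K ζ
  mass_tendsto : Tendsto (fun z => mass (S z)) (𝓝[<] zc) (𝓝 0)

/-- Convolution on ℤ. -/
def convZ (f g : ℤ → ℝ) (x : ℤ) : ℝ := ∑' y, f (x - y) * g y

/-- n-fold convolution power on ℤ. -/
def convZPow (f : ℤ → ℝ) : ℕ → ℤ → ℝ
  | 0 => fun x => if x = 0 then 1 else 0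
  | n + 1 => convZ f (convZPow f n)

/-! ### Scalar estimates -/

theorem abs_cosh_taylor_le {a : ℝ} (ha0 : 0 ≤ a) (ha2 : a ≤ 2) (t : ℝ) :
    |Real.cosh t - 1 - t ^ 2 / 2| ≤ |t| ^ (2 + a) * Real.cosh t := by
  have hc1 : 1 ≤ Real.cosh t := Real.one_le_cosh t
  rcases le_total |t| 1 with ht | ht
  · have h1 := Real.exp_bound ht (n := 4) (by norm_num)
    have h2 := Real.exp_bound (x := -t) (by simpa using ht) (n := 4) (by norm_num)
    simp only [Finset.sum_range_succ, Finset.sum_range_zero, Nat.factorial, abs_neg] at h1 h2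
    norm_num at h1 h2
    rw [abs_le] at h1 h2
    have h4 : t ^ 4 ≤ |t| ^ (2 + a) := by
      rw [← Even.pow_abs (by decide : Even 4), ← Real.rpow_natCast]
      exact Real.rpow_le_rpow_of_exponent_ge' (abs_nonneg t) ht (by positivity)
        (by push_cast; linarith)
    have h5 : 0 ≤ |t| ^ (2 + a) := by positivity
    have h6 : |t| ^ (2 + a) ≤ |t| ^ (2 + a) * Real.cosh t := le_mul_of_one_le_right h5 hc1
    have h7 : 0 ≤ t ^ 4 := by positivity
    have h8 : |t| ^ 4 = t ^ 4 := Even.pow_abs (by decide) t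
    have h9 : (-t) ^ 3 = -t ^ 3 := by ring
    rw [h8] at h1 h2
    rw [h9] at h2
    refine le_trans ?_ h6
    rw [Real.cosh_eq, abs_le]
    constructor <;> linarith
  · have h1 : 1 ≤ |t| ^ (2 + a) := Real.one_le_rpow ht (by positivity)
    have h2 : |Real.cosh t - 1 - t ^ 2 / 2| ≤ Real.cosh t := by
      have h3 : t ^ 2 / 2 ≤ 2 * Real.cosh t - 1 := by
        have h5 := Real.quadratic_le_exp_of_nonneg (abs_nonneg t)
        have h6 := Real.exp_pos (-|t|)
        rw [← Real.cosh_abs, Real.cosh_eq]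
        rw [sq_abs] at h5
        linarith
      rw [abs_le]
      constructor <;> nlinarith [sq_nonneg t]
    exact h2.trans (le_mul_of_one_le_left (by linarith) h1)

theorem abs_cos_taylor_le {a : ℝ} (ha0 : 0 ≤ a) (ha2 : a ≤ 2) (t : ℝ) :
    |1 - Real.cos t - t ^ 2 / 2| ≤ |t| ^ (2 + a) := by
  rcases le_total |t| 1 with ht | ht
  · have h1 := Real.cos_bound ht
    have h4 : |t| ^ 4 ≤ |t| ^ (2 + a) := by
      rw [← Real.rpow_natCast]
      exact Real.rpow_le_rpow_of_exponent_ge' (abs_nonneg t) ht (by positivity)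
        (by push_cast; linarith)
    have h7 : 0 ≤ |t| ^ 4 := by positivity
    rw [abs_le] at h1 ⊢
    constructor <;> linarith
  · have h1 : |t| ^ 2 ≤ |t| ^ (2 + a) := by
      rw [← Real.rpow_natCast]
      exact Real.rpow_le_rpow_of_exponent_le ht (by push_cast; linarith)
    rw [sq_abs] at h1
    have h2 := Real.one_sub_sq_div_two_le_cos (x := t)
    have h3 := Real.cos_le_one t
    rw [abs_le]
    constructor <;> nlinarith [sq_nonneg t]

theorem abs_sub_le_of_sq_sub_sq {n m κ B a : ℝ} (hn : 0 ≤ n) (hm : 0 < m) (hκ : 0 < κ)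
    (h : κ * |n ^ 2 - m ^ 2| ≤ B * m ^ (2 + a)) : |n - m| ≤ B / κ * m ^ a * m := by
  have h1 : |n ^ 2 - m ^ 2| = |n - m| * (n + m) := by
    rw [show n ^ 2 - m ^ 2 = (n - m) * (n + m) by ring, abs_mul, abs_of_nonneg (a := n + m)
      (by linarith)]
  have h2 : m ^ (2 + a) = m ^ a * m * m := by
    rw [Real.rpow_add hm, Real.rpow_two]; ring
  have h3 : |n - m| * m ≤ |n ^ 2 - m ^ 2| := by
    rw [h1]; exact mul_le_mul_of_nonneg_left (by linarith) (abs_nonneg _)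
  have h4 : κ * |n - m| * m ≤ (B * (m ^ a * m)) * m := by
    calc κ * |n - m| * m = κ * (|n - m| * m) := by ring
      _ ≤ κ * |n ^ 2 - m ^ 2| := by gcongr
      _ ≤ B * m ^ (2 + a) := h
      _ = _ := by rw [h2]; ring
  have h5 := le_of_mul_le_mul_right h4 hm
  rw [show B / κ * m ^ a * m = (B * (m ^ a * m)) / κ by ring, le_div_iff₀ hκ]
  linarith

/-! ### Dot products and Euclidean norms -/

theorem enormR_nonneg (x : Fin d → ℝ) : 0 ≤ enormR x := Real.sqrt_nonneg _

theorem enormZ_nonneg (x : Fin d → ℤ) : 0 ≤ enormZ x := Real.sqrt_nonneg _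

theorem enormR_sq (x : Fin d → ℝ) : enormR x ^ 2 = ∑ i, x i ^ 2 :=
  Real.sq_sqrt (Finset.sum_nonneg fun _ _ => sq_nonneg _)

theorem enormZ_eq_zero_or_one_le (x : Fin d → ℤ) : enormZ x = 0 ∨ 1 ≤ enormZ x := by
  have h : enormZ x = Real.sqrt ((∑ i, (x i) ^ 2 : ℤ) : ℝ) := by
    unfold enormZ; push_cast; rfl
  rcases (Finset.sum_nonneg fun i _ => sq_nonneg (x i) :
    0 ≤ ∑ i, (x i) ^ 2).eq_or_lt with h0 | h0
  · left; rw [h, ← h0]; simp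
  · right
    rw [h, Real.one_le_sqrt]
    exact_mod_cast h0

theorem abs_rdot_le (μ x : Fin d → ℝ) : |rdot μ x| ≤ enormR μ * enormR x := by
  refine abs_le_of_sq_le_sq ?_ (mul_nonneg (enormR_nonneg _) (enormR_nonneg _))
  rw [mul_pow, enormR_sq, enormR_sq]
  exact Finset.sum_mul_sq_le_sq_mul_sq _ _ _

theorem abs_rdotZ_le (μ : Fin d → ℝ) (x : Fin d → ℤ) : |rdotZ μ x| ≤ enormR μ * enormZ x :=
  abs_rdot_le μ (toR x)

theorem enormR_smul {t : ℝ} (ht : 0 ≤ t) (x : Fin d → ℝ) : enormR (t • x) = t * enormR x := by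
  unfold enormR
  simp only [Pi.smul_apply, smul_eq_mul, mul_pow, ← Finset.mul_sum]
  rw [Real.sqrt_mul (sq_nonneg t), Real.sqrt_sq ht]

theorem rdot_smul_self (t : ℝ) (x : Fin d → ℝ) : rdot (t • x) x = t * enormR x ^ 2 := by
  rw [enormR_sq, rdot, Finset.mul_sum]
  exact Finset.sum_congr rfl fun i _ => by simp only [Pi.smul_apply, smul_eq_mul]; ring

theorem enormR_le_card_mul {μ : Fin d → ℝ} {m : ℝ} (hd : 1 ≤ d) (hm : 0 ≤ m)
    (h : ∀ i, |μ i| ≤ m) : enormR μ ≤ d * m := by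
  have hd' : (1 : ℝ) ≤ d := by exact_mod_cast hd
  refine Real.sqrt_le_iff.2 ⟨by positivity, ?_⟩
  calc ∑ i, μ i ^ 2 ≤ ∑ _i : Fin d, m ^ 2 :=
        Finset.sum_le_sum fun i _ => sq_le_sq.2 (by rw [abs_of_nonneg hm]; exact h i)
    _ = d * m ^ 2 := by simp
    _ ≤ (d * m) ^ 2 := by nlinarith [sq_nonneg m]

theorem e1R_eq_single (hd : 1 ≤ d) (t : ℝ) : e1R d t = Pi.single (⟨0, hd⟩ : Fin d) t := by
  funext i
  by_cases h : i = ⟨0, hd⟩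
  · subst h; simp [e1R]
  · have h' : (i : ℕ) ≠ 0 := fun h0 => h (Fin.ext h0)
    simp [e1R, h, h']

theorem enormR_single (i : Fin d) (t : ℝ) : enormR (Pi.single i t) = |t| := by
  unfold enormR
  rw [Finset.sum_eq_single i (fun j _ hj => by simp [hj]) (by simp)]
  simp [Real.sqrt_sq_eq_abs]

theorem rdotZ_smul (s : ℝ) (μ : Fin d → ℝ) (y : Fin d → ℤ) :
    rdotZ (s • μ) y = s * rdotZ μ y := by
  simp [rdotZ, Finset.mul_sum, mul_assoc]

theorem rdotZ_add (μ ν : Fin d → ℝ) (y : Fin d → ℤ) :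
    rdotZ (μ + ν) y = rdotZ μ y + rdotZ ν y := by
  simp [rdotZ, add_mul, Finset.sum_add_distrib]

theorem rdotZ_sub (μ : Fin d → ℝ) (x y : Fin d → ℤ) :
    rdotZ μ (x - y) = rdotZ μ x - rdotZ μ y := by
  simp [rdotZ, mul_sub, Finset.sum_sub_distrib]

theorem rdotZ_neg (μ : Fin d → ℝ) (y : Fin d → ℤ) : rdotZ μ (-y) = -rdotZ μ y := by
  simp [rdotZ]

theorem rdotZ_zero (y : Fin d → ℤ) : rdotZ (0 : Fin d → ℝ) y = 0 := by simp [rdotZ]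

theorem enormZ_neg (y : Fin d → ℤ) : enormZ (-y) = enormZ y := by simp [enormZ]

theorem tilt_zero (f : (Fin d → ℤ) → ℝ) : tilt f 0 = f := by
  funext x; simp [tilt, rdotZ_zero]

/-! ### Symmetries of the lattice -/

/-- Sign flips of lattice points, as a bijection. -/
def flipEquiv (ε : Fin d → Bool) : (Fin d → ℤ) ≃ (Fin d → ℤ) :=
  Function.Involutive.toPerm (fun x i => if ε i then -(x i) else x i) fun x => by
    funext i; cases h : ε i <;> simp [h]

@[simp] theorem flipEquiv_apply (ε : Fin d → Bool) (x : Fin d → ℤ) (i : Fin d) :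
    flipEquiv ε x i = if ε i then -(x i) else x i := rfl

/-- Coordinate permutations of lattice points, as a bijection. -/
def permEquiv (σ : Equiv.Perm (Fin d)) : (Fin d → ℤ) ≃ (Fin d → ℤ) where
  toFun x := fun i => x (σ i)
  invFun x := fun i => x (σ.symm i)
  left_inv x := by simp
  right_inv x := by simp

@[simp] theorem permEquiv_apply (σ : Equiv.Perm (Fin d)) (x : Fin d → ℤ) (i : Fin d) :
    permEquiv σ x i = x (σ i) := rfl

theorem ZdSymmetric.neg {f : (Fin d → ℤ) → ℝ} (hf : ZdSymmetric f) (x : Fin d → ℤ) :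
    f (-x) = f x := by
  rw [← hf.2 (fun _ => true) x]; rfl

/-! ### Geometry of the domain of finite susceptibility -/

theorem mem_Omega_iff {S : (Fin d → ℤ) → ℝ} (hS : ∀ x, 0 ≤ S x) (μ : Fin d → ℝ) :
    μ ∈ Omega S ↔ Summable (tilt S μ) := by
  have hpos : ∀ x, 0 ≤ tilt S μ x := fun x => mul_nonneg (hS x) (Real.exp_pos _).le
  constructor
  · intro h
    have := ENNReal.summable_toReal (ne_of_lt h)
    refine this.congr fun x => ?_
    exact ENNReal.toReal_ofReal (hpos x)
  · intro h
    change ∑' x, ENNReal.ofReal (tilt S μ x) < ⊤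
    rw [← ENNReal.ofReal_tsum_of_nonneg hpos h]
    exact ENNReal.ofReal_lt_top

theorem convex_Omega {S : (Fin d → ℤ) → ℝ} (hS : ∀ x, 0 ≤ S x) : Convex ℝ (Omega S) := by
  intro μ hμ ν hν a b ha hb hab
  rw [mem_Omega_iff hS] at *
  refine Summable.of_nonneg_of_le (fun x => mul_nonneg (hS x) (Real.exp_pos _).le)
    (fun x => ?_) (hμ.add hν)
  simp only [tilt]
  rw [← mul_add, rdotZ_add, rdotZ_smul, rdotZ_smul]
  refine mul_le_mul_of_nonneg_left ?_ (hS x)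
  have h1 : a * rdotZ μ x + b * rdotZ ν x ≤ max (rdotZ μ x) (rdotZ ν x) := by
    have h2 := mul_le_mul_of_nonneg_left (le_max_left (rdotZ μ x) (rdotZ ν x)) ha
    have h3 := mul_le_mul_of_nonneg_left (le_max_right (rdotZ μ x) (rdotZ ν x)) hb
    have h4 : a * max (rdotZ μ x) (rdotZ ν x) + b * max (rdotZ μ x) (rdotZ ν x)
        = max (rdotZ μ x) (rdotZ ν x) := by rw [← add_mul, hab, one_mul]
    linarith
  have h5 := Real.exp_le_exp.2 h1
  have h6 := Real.exp_pos (rdotZ μ x)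
  have h7 := Real.exp_pos (rdotZ ν x)
  rcases max_choice (rdotZ μ x) (rdotZ ν x) with h | h <;> rw [h] at h5 <;> linarith

theorem flip_mem_Omega {S : (Fin d → ℤ) → ℝ} (hS : ∀ x, 0 ≤ S x) (hsym : ZdSymmetric S)
    (ε : Fin d → Bool) {μ : Fin d → ℝ} (hμ : μ ∈ Omega S) :
    (fun i => if ε i then -(μ i) else μ i) ∈ Omega S := by
  rw [mem_Omega_iff hS] at *
  rw [← (flipEquiv ε).summable_iff] at hμ
  refine hμ.congr fun x => ?_
  simp only [Function.comp, tilt]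
  rw [show S (flipEquiv ε x) = S x from hsym.2 ε x]
  congr 2
  refine Finset.sum_congr rfl fun i _ => ?_
  cases h : ε i <;> simp [h]

theorem perm_mem_Omega {S : (Fin d → ℤ) → ℝ} (hS : ∀ x, 0 ≤ S x) (hsym : ZdSymmetric S)
    (σ : Equiv.Perm (Fin d)) {μ : Fin d → ℝ} (hμ : μ ∈ Omega S) :
    (fun i => μ (σ i)) ∈ Omega S := by
  rw [mem_Omega_iff hS] at *
  rw [← (permEquiv σ.symm).summable_iff] at hμ
  refine hμ.congr fun x => ?_
  simp only [Function.comp, tilt]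
  rw [show S (permEquiv σ.symm x) = S x from hsym.1 σ.symm x]
  congr 2
  unfold rdotZ
  rw [← Equiv.sum_comp σ]
  simp

theorem single_mem_Omega {S : (Fin d → ℤ) → ℝ} (hS : ∀ x, 0 ≤ S x) (hsym : ZdSymmetric S)
    {μ : Fin d → ℝ} (hμ : μ ∈ Omega S) (i j : Fin d) : Pi.single j |μ i| ∈ Omega S := by
  have h1 : Pi.single i (μ i) ∈ Omega S := by
    have h2 := convex_Omega hS hμ (flip_mem_Omega hS hsym (fun k => decide (k ≠ i)) hμ)
      (a := 1 / 2) (b := 1 / 2) (by norm_num) (by norm_num) (by norm_num)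
    convert h2 using 1
    funext k
    by_cases hk : k = i
    · subst hk; simp; ring
    · simp [hk]
  have h3 : Pi.single i |μ i| ∈ Omega S := by
    rcases le_total 0 (μ i) with h | h
    · rwa [abs_of_nonneg h]
    · have h4 := flip_mem_Omega hS hsym (fun _ => true) h1
      convert h4 using 1
      rw [abs_of_nonpos h]
      funext k
      by_cases hk : k = i
      · subst hk; simp
      · simp [hk]
  have h5 := perm_mem_Omega hS hsym (Equiv.swap i j) h3
  convert h5 using 1
  funext k
  by_cases hk : k = j
  · subst hk; simp
  · rw [Pi.single_eq_of_ne hk, Pi.single_eq_of_ne]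
    intro h
    exact hk ((Equiv.swap i j).injective (h.trans (Equiv.swap_apply_right i j).symm))

/-- The exit point of a ray from a convex open neighbourhood of the origin. -/
theorem exit_point {U : Set (Fin d → ℝ)} (hU : IsOpen U) (hc : Convex ℝ U)
    (h0 : (0 : Fin d → ℝ) ∈ U) {v : Fin d → ℝ} {s : ℝ} (hs : 0 < s) (hsv : s • v ∉ U) :
    0 < sSup {t : ℝ | 0 ≤ t ∧ t • v ∈ U} ∧
      sSup {t : ℝ | 0 ≤ t ∧ t • v ∈ U} • v ∈ closure U ∧
      sSup {t : ℝ | 0 ≤ t ∧ t • v ∈ U} • v ∉ U ∧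
      ∀ t : ℝ, 0 ≤ t → t • v ∈ U → t ≤ sSup {t : ℝ | 0 ≤ t ∧ t • v ∈ U} := by
  set A := {t : ℝ | 0 ≤ t ∧ t • v ∈ U} with hA
  have hcont : Continuous fun t : ℝ => t • v := by fun_prop
  have hne : A.Nonempty := ⟨0, le_rfl, by simpa using h0⟩
  have hbdd : BddAbove A := by
    refine ⟨s, fun t ht => ?_⟩
    by_contra! hlt
    have htpos : 0 < t := hs.trans hlt
    apply hsv
    have := hc h0 ht.2 (a := 1 - s / t) (b := s / t)
      (by rw [sub_nonneg, div_le_one htpos]; exact hlt.le) (by positivity) (by ring)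
    rwa [smul_zero, zero_add, smul_smul, div_mul_cancel₀ _ htpos.ne'] at this
  have hle : ∀ t : ℝ, 0 ≤ t → t • v ∈ U → t ≤ sSup A := fun t h1 h2 => le_csSup hbdd ⟨h1, h2⟩
  have hext : ∀ t : ℝ, 0 ≤ t → t • v ∈ U → ∃ t', t < t' ∧ t' • v ∈ U := by
    intro t _ htU
    obtain ⟨ε, hε, hball⟩ := Metric.isOpen_iff.1 (hU.preimage hcont) t htU
    refine ⟨t + ε / 2, by linarith, hball ?_⟩
    rw [Metric.mem_ball, Real.dist_eq, add_sub_cancel_left, abs_of_pos (by linarith)]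
    linarith
  have hpos : 0 < sSup A := by
    obtain ⟨t', h1, h2⟩ := hext 0 le_rfl (by simpa using h0)
    exact h1.trans_le (hle t' h1.le h2)
  refine ⟨hpos, ?_, ?_, hle⟩
  · have h1 : sSup A ∈ closure A := csSup_mem_closure hne hbdd
    exact map_mem_closure (f := fun t : ℝ => t • v) hcont h1 fun t ht => ht.2
  · intro hmem
    obtain ⟨t', h1, h2⟩ := hext _ hpos.le hmem
    exact absurd (hle t' (hpos.le.trans h1.le) h2) (not_le.2 h1)

theorem mass_eq (hd : 1 ≤ d) (S : (Fin d → ℤ) → ℝ) :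
    mass S = sSup {t : ℝ | 0 ≤ t ∧ t • (Pi.single (⟨0, hd⟩ : Fin d) (1 : ℝ)) ∈ Omega S} := by
  unfold mass
  congr 1
  ext t
  rw [Set.mem_ofPred_eq, Set.mem_ofPred_eq, e1R_eq_single hd, ← Pi.single_smul, smul_eq_mul,
    mul_one]
  rfl

theorem AssumptionOmega.mass_pos_and_boundary {S : (Fin d → ℤ) → ℝ} (hS : AssumptionOmega S)
    (hd : 1 ≤ d) : 0 < mass S ∧
      Pi.single (⟨0, hd⟩ : Fin d) (mass S) ∈ closure (Omega S) \ Omega S ∧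
      ∀ t, 0 ≤ t → Pi.single (⟨0, hd⟩ : Fin d) t ∈ Omega S → t ≤ mass S := by
  obtain ⟨μ₁, h1, h2⟩ := hS.exists_not_mem
  have hsingle : ∀ t : ℝ, t • (Pi.single (⟨0, hd⟩ : Fin d) (1 : ℝ) : Fin d → ℝ)
      = Pi.single (⟨0, hd⟩ : Fin d) t := fun t => by
    rw [← Pi.single_smul, smul_eq_mul, mul_one]
  rw [e1R_eq_single hd, ← hsingle] at h2
  have h := exit_point hS.open_Omega (convex_Omega hS.nonneg) hS.zero_mem h1 h2
  rw [← mass_eq hd] at h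
  simp only [hsingle] at h
  exact ⟨h.1, ⟨h.2.1, h.2.2.1⟩, h.2.2.2⟩

theorem AssumptionOmega.abs_le_mass {S : (Fin d → ℤ) → ℝ} (hS : AssumptionOmega S)
    (hd : 1 ≤ d) {μ : Fin d → ℝ} (hμ : μ ∈ closure (Omega S)) (i : Fin d) :
    |μ i| ≤ mass S := by
  have hcl : IsClosed {ν : Fin d → ℝ | |ν i| ≤ mass S} :=
    isClosed_le (by fun_prop) continuous_const
  refine closure_minimal (fun ν hν => ?_) hcl hμ
  exact (hS.mass_pos_and_boundary hd).2.2 _ (abs_nonneg _)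
    (single_mem_Omega hS.nonneg hS.symm hν i ⟨0, hd⟩)

theorem AssumptionOmega.exists_boundary_ray {S : (Fin d → ℤ) → ℝ} (hS : AssumptionOmega S)
    (hd : 1 ≤ d) {x : Fin d → ℝ} (hx : x ≠ 0) :
    ∃ t : ℝ, 0 < t ∧ t • x ∈ closure (Omega S) \ Omega S := by
  obtain ⟨i, hi⟩ := Function.ne_iff.1 hx
  have hxi : 0 < |x i| := abs_pos.2 hi
  have hm := (hS.mass_pos_and_boundary hd).1
  have hs : 0 < (mass S + 1) / |x i| := by positivity
  have hnot : ((mass S + 1) / |x i|) • x ∉ Omega S := fun h => by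
    have h1 := hS.abs_le_mass hd (subset_closure h) i
    rw [Pi.smul_apply, smul_eq_mul, abs_mul, abs_of_pos hs, div_mul_cancel₀ _ hxi.ne'] at h1
    linarith
  have h := exit_point hS.open_Omega (convex_Omega hS.nonneg) hS.zero_mem hs hnot
  exact ⟨_, h.1, h.2.1, h.2.2.1⟩

/-! ### Weighted sums of the kernel -/

theorem lpNorm_one_le {f : (Fin d → ℤ) → ℝ} {M : ℝ} (hM : 0 ≤ M)
    (h : lpNorm f 1 ≤ ENNReal.ofReal M) : (Summable fun y => |f y|) ∧ ∑' y, |f y| ≤ M := by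
  simp only [lpNorm, Real.rpow_one, div_one, ENNReal.rpow_one] at h
  have hs : Summable fun y => |f y| :=
    (ENNReal.summable_toReal (h.trans_lt ENNReal.ofReal_lt_top).ne).congr fun y =>
      ENNReal.toReal_ofReal (abs_nonneg _)
  refine ⟨hs, ?_⟩
  rw [← ENNReal.ofReal_tsum_of_nonneg (fun _ => abs_nonneg _) hs] at h
  exact (ENNReal.ofReal_le_ofReal_iff hM).1 h

theorem hasSum_mul_cosh {f : (Fin d → ℤ) → ℝ} (hf : ∀ y, f (-y) = f y) {μ : Fin d → ℝ} {s : ℝ}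
    (h : HasSum (tilt f μ) s) : HasSum (fun y => f y * Real.cosh (rdotZ μ y)) s := by
  have h1 := (Equiv.hasSum_iff (Equiv.neg (Fin d → ℤ))).2 h
  have h2 := (h.add h1).div_const 2
  rw [show (s + s) / 2 = s by ring] at h2
  have h3 : (fun y => f y * Real.cosh (rdotZ μ y)) =
      fun y => (tilt f μ y + (tilt f μ ∘ Equiv.neg (Fin d → ℤ)) y) / 2 := by
    funext y
    simp only [Function.comp, Equiv.neg_apply, tilt, rdotZ_neg, hf, Real.cosh_eq]
    ring
  rwa [h3]

/-- The tilted sums of a convolution multiply. -/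
theorem hasSum_tilt_conv {f g : (Fin d → ℤ) → ℝ} {μ : Fin d → ℝ}
    (hf : Summable (tilt f μ)) (hg : Summable (tilt g μ)) :
    HasSum (tilt (conv f g) μ) (tiltSum f μ * tiltSum g μ) := by
  let e : (Fin d → ℤ) × (Fin d → ℤ) ≃ (Fin d → ℤ) × (Fin d → ℤ) :=
    { toFun := fun p => (p.1 - p.2, p.2)
      invFun := fun p => (p.1 + p.2, p.2)
      left_inv := fun p => by simp
      right_inv := fun p => by simp }
  have h1 : HasSum (fun p : (Fin d → ℤ) × (Fin d → ℤ) => tilt f μ p.1 * tilt g μ p.2)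
      (tiltSum f μ * tiltSum g μ) := by
    have h2 := tsum_mul_tsum_of_summable_norm hf.norm hg.norm
    have h3 := summable_mul_of_summable_norm hf.norm hg.norm
    change HasSum _ ((∑' y, tilt f μ y) * ∑' y, tilt g μ y)
    rw [h2]
    exact h3.hasSum
  have h2 := (Equiv.hasSum_iff e).2 h1
  refine h2.prod_fiberwise fun x => ?_
  have h3 := (h2.summable.prod_factor x).hasSum
  suffices heq : tilt (conv f g) μ x = ∑' y, (_ : ℝ) from heq ▸ h3
  change conv f g x * Real.exp (rdotZ μ x) = _
  rw [conv, ← tsum_mul_right]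
  refine tsum_congr fun y => ?_
  simp only [Function.comp, e, Equiv.coe_fn_mk, tilt]
  rw [rdotZ_sub, Real.exp_sub]
  field_simp

/-- The second moment of a kernel in one coordinate direction. -/
def coordMoment (J : (Fin d → ℤ) → ℝ) (i : Fin d) : ℝ := ∑' y, J y * (y i : ℝ) ^ 2

theorem coordMoment_eq {J : (Fin d → ℤ) → ℝ} (hJ : ZdSymmetric J) (i j : Fin d) :
    coordMoment J i = coordMoment J j := by
  unfold coordMoment
  rw [← (permEquiv (Equiv.swap i j)).tsum_eq]
  refine tsum_congr fun y => ?_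
  rw [show J (permEquiv (Equiv.swap i j) y) = J y from hJ.1 _ y]
  simp

theorem tsum_mul_coord_mul_coord_eq_zero {J : (Fin d → ℤ) → ℝ} (hJ : ZdSymmetric J)
    {i j : Fin d} (hij : i ≠ j) : ∑' y, J y * ((y i : ℝ) * (y j : ℝ)) = 0 := by
  have h : ∑' y, J y * ((y i : ℝ) * (y j : ℝ)) = -∑' y, J y * ((y i : ℝ) * (y j : ℝ)) := by
    conv_lhs => rw [← (flipEquiv fun k => decide (k = i)).tsum_eq]
    rw [← tsum_neg]
    refine tsum_congr fun y => ?_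
    rw [show J (flipEquiv (fun k => decide (k = i)) y) = J y from hJ.2 _ y]
    simp [hij.symm]
  linarith

theorem enormZ_rpow_le {p r : ℝ} (hp : 0 < p) (hpr : p ≤ r) (y : Fin d → ℤ) :
    enormZ y ^ p ≤ enormZ y ^ r := by
  rcases enormZ_eq_zero_or_one_le y with h | h
  · rw [h, Real.zero_rpow hp.ne', Real.zero_rpow (by linarith)]
  · exact Real.rpow_le_rpow_of_exponent_le h hpr

theorem abs_coord_le (y : Fin d → ℤ) (i : Fin d) : |(y i : ℝ)| ≤ enormZ y := by
  refine Real.le_sqrt_of_sq_le ?_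
  rw [sq_abs]
  exact Finset.single_le_sum (f := fun i => (y i : ℝ) ^ 2) (fun _ _ => sq_nonneg _)
    (Finset.mem_univ i)

theorem summable_mul_coord_mul_coord {J : (Fin d → ℤ) → ℝ} {ζ : ℝ} (hζ : 0 < ζ)
    (h : Summable fun y => |enormZ y ^ (2 + ζ) * J y|) (i j : Fin d) :
    Summable fun y => J y * ((y i : ℝ) * (y j : ℝ)) := by
  refine Summable.of_norm_bounded h fun y => ?_
  rw [Real.norm_eq_abs, abs_mul, abs_mul, abs_mul, mul_comm,
    abs_of_nonneg (Real.rpow_nonneg (enormZ_nonneg y) _)]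
  refine mul_le_mul_of_nonneg_right ?_ (abs_nonneg _)
  have h1 := enormZ_rpow_le (p := 2) (r := 2 + ζ) (by norm_num) (by linarith) y
  rw [Real.rpow_two] at h1
  have h2 := mul_le_mul (abs_coord_le y i) (abs_coord_le y j) (abs_nonneg _) (enormZ_nonneg y)
  nlinarith

theorem hasSum_mul_rdotZ_sq {J : (Fin d → ℤ) → ℝ} (hJ : ZdSymmetric J) {ζ : ℝ} (hζ : 0 < ζ)
    (h : Summable fun y => |enormZ y ^ (2 + ζ) * J y|) (i₀ : Fin d) (μ : Fin d → ℝ) :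
    HasSum (fun y => J y * rdotZ μ y ^ 2) (coordMoment J i₀ * enormR μ ^ 2) := by
  have h1 : ∀ i j, HasSum (fun y => μ i * μ j * (J y * ((y i : ℝ) * (y j : ℝ))))
      (μ i * μ j * if i = j then coordMoment J i₀ else 0) := by
    intro i j
    refine HasSum.mul_left _ ?_
    have h2 := (summable_mul_coord_mul_coord hζ h i j).hasSum
    split_ifs with hij
    · subst hij
      rw [coordMoment_eq hJ i₀ i]
      simp only [← sq] at h2 ⊢
      exact h2
    · rwa [tsum_mul_coord_mul_coord_eq_zero hJ hij] at h2
  have h3 := hasSum_sum (s := Finset.univ) fun i _ =>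
    hasSum_sum (s := Finset.univ) fun j _ => h1 i j
  convert h3 using 1
  · funext y
    rw [rdotZ, sq, Finset.sum_mul_sum, Finset.mul_sum]
    refine Finset.sum_congr rfl fun i _ => ?_
    rw [Finset.mul_sum]
    exact Finset.sum_congr rfl fun j _ => by ring
  · rw [enormR_sq, Finset.mul_sum]
    refine Finset.sum_congr rfl fun i _ => ?_
    simp only [mul_ite, mul_zero, Finset.sum_ite_eq, Finset.mem_univ, if_true]
    ring

theorem abs_rdotZ_rpow_le {a ζ : ℝ} (ha : 0 ≤ a) (haζ : a ≤ ζ) (μ : Fin d → ℝ)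
    (y : Fin d → ℤ) : |rdotZ μ y| ^ (2 + a) ≤ enormR μ ^ (2 + a) * enormZ y ^ (2 + ζ) := by
  calc |rdotZ μ y| ^ (2 + a) ≤ (enormR μ * enormZ y) ^ (2 + a) :=
        Real.rpow_le_rpow (abs_nonneg _) (abs_rdotZ_le μ y) (by positivity)
    _ = enormR μ ^ (2 + a) * enormZ y ^ (2 + a) :=
        Real.mul_rpow (enormR_nonneg _) (enormZ_nonneg _)
    _ ≤ _ := mul_le_mul_of_nonneg_left (enormZ_rpow_le (by linarith) (by linarith) y)
        (Real.rpow_nonneg (enormR_nonneg _) _)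

/-- Second-order expansion of the tilted mass of a symmetric kernel. -/
theorem abs_tiltSum_sub_le {J : (Fin d → ℤ) → ℝ} (hJ : ZdSymmetric J) (hJs : Summable J)
    {ζ M a : ℝ} (ha : 0 ≤ a) (haζ : a ≤ ζ) (ha2 : a ≤ 2) (hζ : 0 < ζ)
    (h0 : Summable fun y => |enormZ y ^ (2 + ζ) * J y|) {μ : Fin d → ℝ}
    (hμs : Summable (tilt J μ))
    (hμ : Summable fun y => |enormZ y ^ (2 + ζ) * tilt J μ y|)
    (hμM : ∑' y, |enormZ y ^ (2 + ζ) * tilt J μ y| ≤ M) (i₀ : Fin d) :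
    |tiltSum J μ - ∑' y, J y - coordMoment J i₀ / 2 * enormR μ ^ 2| ≤
      M * enormR μ ^ (2 + a) := by
  have h1 : HasSum (fun y => J y * Real.cosh (rdotZ μ y)) (tiltSum J μ) :=
    hasSum_mul_cosh hJ.neg hμs.hasSum
  have h2 := ((hasSum_mul_rdotZ_sq hJ hζ h0 i₀ μ).div_const 2)
  have h3 := (h1.sub hJs.hasSum).sub h2
  have h4 : HasSum (fun y => (enormZ y ^ (2 + ζ) * |J y|) * Real.cosh (rdotZ μ y))
      (∑' y, |enormZ y ^ (2 + ζ) * tilt J μ y|) := by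
    refine hasSum_mul_cosh (fun y => by rw [enormZ_neg, hJ.neg]) ?_
    convert hμ.hasSum using 1
    funext y
    rw [tilt, tilt, abs_mul, abs_mul, Real.abs_exp,
      abs_of_nonneg (Real.rpow_nonneg (enormZ_nonneg y) _)]
    ring
  have h5 := h4.mul_right (enormR μ ^ (2 + a))
  have h6 : ∀ y, ‖J y * Real.cosh (rdotZ μ y) - J y - J y * rdotZ μ y ^ 2 / 2‖ ≤
      (enormZ y ^ (2 + ζ) * |J y|) * Real.cosh (rdotZ μ y) * enormR μ ^ (2 + a) := by
    intro y
    rw [show J y * Real.cosh (rdotZ μ y) - J y - J y * rdotZ μ y ^ 2 / 2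
      = J y * (Real.cosh (rdotZ μ y) - 1 - rdotZ μ y ^ 2 / 2) by ring, Real.norm_eq_abs, abs_mul]
    calc |J y| * |Real.cosh (rdotZ μ y) - 1 - rdotZ μ y ^ 2 / 2|
        ≤ |J y| * ((enormR μ ^ (2 + a) * enormZ y ^ (2 + ζ)) * Real.cosh (rdotZ μ y)) := by
          refine mul_le_mul_of_nonneg_left ((abs_cosh_taylor_le ha ha2 _).trans ?_) (abs_nonneg _)
          exact mul_le_mul_of_nonneg_right (abs_rdotZ_rpow_le ha haζ μ y) (Real.cosh_pos _).le
      _ = _ := by ring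
  have h7 := tsum_of_norm_bounded h5 h6
  rw [h3.tsum_eq, Real.norm_eq_abs] at h7
  rw [div_mul_eq_mul_div]
  exact h7.trans (mul_le_mul_of_nonneg_right hμM (Real.rpow_nonneg (enormR_nonneg _) _))

theorem hasSum_re_fourierZ_sub {J : (Fin d → ℤ) → ℝ} (hJs : Summable J) (k : Fin d → ℝ) :
    HasSum (fun y => J y - J y * Real.cos (rdotZ k y)) (fourierZ J 0 - fourierZ J k).re := by
  have h1 : ∀ k : Fin d → ℝ,
      HasSum (fun y => J y * Real.cos (rdotZ k y)) (fourierZ J k).re := by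
    intro k
    have h2 : Summable fun y =>
        (J y : ℂ) * Complex.exp (-Complex.I * (rdotZ k y : ℂ)) := by
      refine Summable.of_norm_bounded hJs.norm fun y => ?_
      rw [norm_mul, Complex.norm_real, Complex.norm_exp]
      simp
    have h3 := Complex.hasSum_re h2.hasSum
    have h4 : ∀ y, ((J y : ℂ) * Complex.exp (-Complex.I * (rdotZ k y : ℂ))).re
        = J y * Real.cos (rdotZ k y) := fun y => by
      rw [Complex.re_ofReal_mul, Complex.exp_re]
      simp
    simp only [h4] at h3
    exact h3
  have h2 := (h1 0).sub (h1 k)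
  simpa [rdotZ_zero] using h2

theorem infrared_le_coordMoment {J : (Fin d → ℤ) → ℝ} (hJ : ZdSymmetric J) (hJs : Summable J)
    {ζ M K a : ℝ} (ha : 0 < a) (haζ : a ≤ ζ) (ha2 : a ≤ 2) (hζ : 0 < ζ)
    (h0 : Summable fun y => |enormZ y ^ (2 + ζ) * J y|)
    (h0M : ∑' y, |enormZ y ^ (2 + ζ) * J y| ≤ M)
    (hIR : ∀ k : Fin d → ℝ, (∀ i, |k i| ≤ π) →
      K * enormR k ^ 2 ≤ (fourierZ J 0 - fourierZ J k).re) (i₀ : Fin d) :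
    K ≤ coordMoment J i₀ / 2 := by
  have key : ∀ t : ℝ, 0 < t → t ≤ 1 → K ≤ coordMoment J i₀ / 2 + M * t ^ a := by
    intro t ht ht1
    set k : Fin d → ℝ := Pi.single i₀ t
    have hk : enormR k = t := by rw [enormR_single, abs_of_pos ht]
    have h1 := hIR k fun i => by
      have hpi := Real.pi_gt_three
      by_cases hi : i = i₀
      · subst hi; simp only [k, Pi.single_eq_same, abs_of_pos ht]; linarith
      · simp only [k, Pi.single_eq_of_ne hi, abs_zero]; linarith
    have h3 := (hasSum_re_fourierZ_sub hJs k).sub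
      ((hasSum_mul_rdotZ_sq hJ hζ h0 i₀ k).div_const 2)
    have h5 := h0.hasSum.mul_right (enormR k ^ (2 + a))
    have h6 : ∀ y, ‖J y - J y * Real.cos (rdotZ k y) - J y * rdotZ k y ^ 2 / 2‖ ≤
        |enormZ y ^ (2 + ζ) * J y| * enormR k ^ (2 + a) := by
      intro y
      rw [show J y - J y * Real.cos (rdotZ k y) - J y * rdotZ k y ^ 2 / 2
        = J y * (1 - Real.cos (rdotZ k y) - rdotZ k y ^ 2 / 2) by ring, Real.norm_eq_abs, abs_mul,
        abs_mul, abs_of_nonneg (Real.rpow_nonneg (enormZ_nonneg y) _)]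
      calc |J y| * |1 - Real.cos (rdotZ k y) - rdotZ k y ^ 2 / 2|
          ≤ |J y| * (enormR k ^ (2 + a) * enormZ y ^ (2 + ζ)) :=
            mul_le_mul_of_nonneg_left ((abs_cos_taylor_le ha.le ha2 _).trans
              (abs_rdotZ_rpow_le ha.le haζ k y)) (abs_nonneg _)
        _ = _ := by ring
    have h7 := tsum_of_norm_bounded h5 h6
    rw [h3.tsum_eq, Real.norm_eq_abs, hk] at h7
    rw [hk] at h1
    have h8 := h7.trans (mul_le_mul_of_nonneg_right h0M (Real.rpow_nonneg ht.le _))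
    have h9 := (le_abs_self _).trans h8
    rw [Real.rpow_add ht, Real.rpow_two] at h9
    have h10 : K * t ^ 2 ≤ (coordMoment J i₀ / 2 + M * t ^ a) * t ^ 2 := by linarith
    exact le_of_mul_le_mul_right h10 (by positivity)
  have hlim : Tendsto (fun t : ℝ => coordMoment J i₀ / 2 + M * t ^ a) (𝓝[>] 0)
      (𝓝 (coordMoment J i₀ / 2 + M * 0 ^ a)) :=
    (((Real.continuous_rpow_const ha.le).const_mul M).const_add _).continuousWithinAt
  rw [Real.zero_rpow ha.ne', mul_zero, add_zero] at hlim
  refine ge_of_tendsto hlim ?_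
  filter_upwards [Ioc_mem_nhdsGT (zero_lt_one' ℝ)] with t ht
  exact key t ht.1 ht.2

/-! ### The tilted kernel on the boundary of the domain -/

theorem tendsto_tiltSum_smul {f : (Fin d → ℤ) → ℝ} {μ : Fin d → ℝ} (hf : Summable f)
    (hμ : Summable (tilt f μ)) :
    Tendsto (fun s : ℝ => tiltSum f (s • μ)) (𝓝[<] 1) (𝓝 (tiltSum f μ)) := by
  refine tendsto_tsum_of_dominated_convergence (bound := fun y => |f y| + |tilt f μ y|)
    (hf.abs.add hμ.abs) (fun y => ?_) ?_
  · have h : Continuous fun s : ℝ => f y * Real.exp (rdotZ (s • μ) y) := by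
      simp only [rdotZ_smul]; fun_prop
    have := h.tendsto 1
    rw [one_smul] at this
    exact this.mono_left nhdsWithin_le_nhds
  · filter_upwards [Ico_mem_nhdsLT (zero_lt_one' ℝ)] with s hs y
    rw [Real.norm_eq_abs, tilt, abs_mul, abs_mul, Real.abs_exp, Real.abs_exp, rdotZ_smul]
    rw [← mul_one_add]
    refine mul_le_mul_of_nonneg_left ?_ (abs_nonneg _)
    have hpos := Real.exp_pos (rdotZ μ y)
    rcases le_total 0 (rdotZ μ y) with h | h
    · have := Real.exp_le_exp.2 (mul_le_of_le_one_left h hs.2.le)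
      linarith
    · have := Real.exp_le_one_iff.2 (mul_nonpos_of_nonneg_of_nonpos hs.1 h)
      linarith

section Boundary

variable {S J h : (Fin d → ℤ) → ℝ} {M K ζ : ℝ}

theorem AssumptionJ.summable_tilt (hJ : AssumptionJ S J h M K ζ) {μ : Fin d → ℝ}
    (hμ : μ ∈ closure (Omega S)) : Summable (tilt J μ) ∧ Summable (tilt h μ) :=
  ⟨(lpNorm_one_le hJ.M_pos.le (hJ.memQ μ hμ).Q_l1).1.of_abs,
    (lpNorm_one_le hJ.M_pos.le (hJ.memQ μ hμ).g_l1).1.of_abs⟩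

theorem AssumptionJ.tiltSum_eq (hJ : AssumptionJ S J h M K ζ) (hS : AssumptionOmega S)
    {μ : Fin d → ℝ} (hμ : μ ∈ Omega S) :
    tiltSum S μ * (1 - tiltSum J μ) = tiltSum h μ := by
  obtain ⟨h1, h2⟩ := hJ.summable_tilt (subset_closure hμ)
  have h3 := (mem_Omega_iff hS.nonneg μ).1 hμ
  have h4 := h2.hasSum.add (hasSum_tilt_conv h1 h3)
  have h5 : HasSum (tilt S μ) (tiltSum h μ + tiltSum J μ * tiltSum S μ) := by
    have hfun : tilt S μ = fun x => tilt h μ x + tilt (conv J S) μ x := by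
      funext x
      rw [tilt, tilt, tilt, hJ.OZ_eq x]; ring
    rw [hfun]
    exact h4
  have h6 : tiltSum S μ = tiltSum h μ + tiltSum J μ * tiltSum S μ := h5.tsum_eq
  linarith

theorem AssumptionJ.tiltSum_lt_one (hJ : AssumptionJ S J h M K ζ) (hS : AssumptionOmega S)
    {μ : Fin d → ℝ} (hμ : μ ∈ Omega S) : tiltSum J μ < 1 := by
  have h1 := hJ.tiltSum_eq hS hμ
  have h2 := hJ.hhat_pos μ (subset_closure hμ)
  have h3 : 0 ≤ tiltSum S μ :=
    tsum_nonneg fun x => mul_nonneg (hS.nonneg x) (Real.exp_pos _).le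
  rw [← h1] at h2
  linarith [pos_of_mul_pos_right h2 h3]

theorem AssumptionOmega.smul_mem (hS : AssumptionOmega S) {μ : Fin d → ℝ}
    (hμ : μ ∈ closure (Omega S)) {s : ℝ} (hs : s ∈ Set.Ico (0 : ℝ) 1) : s • μ ∈ Omega S := by
  rcases hs.1.eq_or_lt with h0 | h0
  · rw [← h0, zero_smul]; exact hS.zero_mem
  · have h1 : (0 : Fin d → ℝ) ∈ interior (Omega S) := by
      rw [hS.open_Omega.interior_eq]; exact hS.zero_mem
    refine interior_subset ((convex_Omega hS.nonneg).openSegment_interior_closure_subset_interior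
      h1 hμ ⟨1 - s, s, by linarith [hs.2], h0, by ring, by simp⟩)

theorem AssumptionJ.tendsto_tiltSum (hJ : AssumptionJ S J h M K ζ)
    {μ : Fin d → ℝ} (hμ : μ ∈ closure (Omega S)) :
    Tendsto (fun s : ℝ => tiltSum J (s • μ)) (𝓝[<] 1) (𝓝 (tiltSum J μ)) ∧
      Tendsto (fun s : ℝ => tiltSum h (s • μ)) (𝓝[<] 1) (𝓝 (tiltSum h μ)) :=
  ⟨tendsto_tiltSum_smul hJ.J_summable.of_abs (hJ.summable_tilt hμ).1,
    tendsto_tiltSum_smul hJ.h_summable.of_abs (hJ.summable_tilt hμ).2⟩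

theorem AssumptionJ.tiltSum_le_one (hJ : AssumptionJ S J h M K ζ) (hS : AssumptionOmega S)
    {μ : Fin d → ℝ} (hμ : μ ∈ closure (Omega S)) : tiltSum J μ ≤ 1 := by
  refine le_of_tendsto (hJ.tendsto_tiltSum hμ).1 ?_
  filter_upwards [Ico_mem_nhdsLT (zero_lt_one' ℝ)] with s hs
  exact (hJ.tiltSum_lt_one hS (hS.smul_mem hμ hs)).le

theorem AssumptionJ.tiltSum_eq_one (hJ : AssumptionJ S J h M K ζ) (hS : AssumptionOmega S)
    {μ : Fin d → ℝ} (hμ : μ ∈ closure (Omega S) \ Omega S) : tiltSum J μ = 1 := by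
  refine le_antisymm (hJ.tiltSum_le_one hS hμ.1) ?_
  by_contra! hlt
  apply hμ.2
  rw [mem_Omega_iff hS.nonneg]
  obtain ⟨h1, h2⟩ := hJ.tendsto_tiltSum hμ.1
  have h3 := h2.div (h1.const_sub 1) (by linarith)
  refine summable_of_sum_le (fun x => mul_nonneg (hS.nonneg x) (Real.exp_pos _).le)
    (c := tiltSum h μ / (1 - tiltSum J μ)) fun A => ?_
  have h4 : Tendsto (fun s : ℝ => ∑ x ∈ A, tilt S (s • μ) x) (𝓝[<] 1)
      (𝓝 (∑ x ∈ A, tilt S μ x)) := by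
    have h5 : Continuous fun s : ℝ => ∑ x ∈ A, tilt S (s • μ) x := by
      simp only [tilt, rdotZ_smul]; fun_prop
    have h6 := h5.tendsto 1
    simp only [one_smul] at h6
    exact h6.mono_left nhdsWithin_le_nhds
  refine le_of_tendsto_of_tendsto h4 h3 ?_
  filter_upwards [Ico_mem_nhdsLT (zero_lt_one' ℝ)] with s hs
  have hmem := hS.smul_mem hμ.1 hs
  have h7 := hJ.tiltSum_lt_one hS hmem
  have h8 : tiltSum S (s • μ) = tiltSum h (s • μ) / (1 - tiltSum J (s • μ)) := by
    rw [eq_div_iff (by linarith)]; exact hJ.tiltSum_eq hS hmem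
  simp only [Pi.div_apply]
  rw [← h8]
  exact ((mem_Omega_iff hS.nonneg _).1 hmem).sum_le_tsum A
    fun x _ => mul_nonneg (hS.nonneg x) (Real.exp_pos _).le

theorem AssumptionJ.enormR_estimate (hJ : AssumptionJ S J h M K ζ) (hS : AssumptionOmega S)
    (hd : 1 ≤ d) {μ : Fin d → ℝ} (hμ : μ ∈ closure (Omega S)) :
    enormR μ - mass S ≤ M * ((d : ℝ) ^ (2 + min ζ 2) + 1) / K * mass S ^ min ζ 2 * mass S ∧
      (μ ∉ Omega S → |enormR μ - mass S| ≤
        M * ((d : ℝ) ^ (2 + min ζ 2) + 1) / K * mass S ^ min ζ 2 * mass S) := by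
  obtain ⟨hm, hmb, -⟩ := hS.mass_pos_and_boundary hd
  set m := mass S
  set a := min ζ 2
  set i₀ : Fin d := ⟨0, hd⟩
  set B := M * ((d : ℝ) ^ (2 + a) + 1)
  have hζ := hJ.zeta_pos
  have hM := hJ.M_pos
  have ha : 0 < a := lt_min hζ two_pos
  have haζ : a ≤ ζ := min_le_left _ _
  have ha2 : a ≤ 2 := min_le_right _ _
  have hB : 0 ≤ B := by positivity
  have hJs : Summable J := hJ.J_summable.of_abs
  have hQ0 := hJ.memQ 0 (subset_closure hS.zero_mem)
  rw [tilt_zero] at hQ0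
  obtain ⟨h0, h0M⟩ := lpNorm_one_le hM.le hQ0.Q_moment
  set q := coordMoment J i₀ / 2
  have hq : K ≤ q :=
    infrared_le_coordMoment hJ.J_symm hJs ha haζ ha2 hζ h0 h0M hQ0.infrared i₀
  have expand : ∀ ν ∈ closure (Omega S),
      |tiltSum J ν - ∑' y, J y - q * enormR ν ^ 2| ≤ M * enormR ν ^ (2 + a) := fun ν hν => by
    obtain ⟨h1, h2⟩ := lpNorm_one_le hM.le (hJ.memQ ν hν).Q_moment
    exact abs_tiltSum_sub_le hJ.J_symm hJs ha.le haζ ha2 hζ h0 (hJ.summable_tilt hν).1 h1 h2 i₀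
  have hmE := expand _ hmb.1
  rw [hJ.tiltSum_eq_one hS hmb, enormR_single, abs_of_pos hm] at hmE
  have hμE := expand μ hμ
  have hpow : enormR μ ^ (2 + a) ≤ (d : ℝ) ^ (2 + a) * m ^ (2 + a) := by
    rw [← Real.mul_rpow (by positivity) hm.le]
    exact Real.rpow_le_rpow (enormR_nonneg μ)
      (enormR_le_card_mul hd hm.le (hS.abs_le_mass hd hμ)) (by positivity)
  have hpow' := mul_le_mul_of_nonneg_left hpow hM.le
  have hBm : B * m ^ (2 + a) = M * ((d : ℝ) ^ (2 + a) * m ^ (2 + a)) + M * m ^ (2 + a) := by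
    simp only [B]; ring
  rw [abs_le] at hmE hμE
  have hone := hJ.tiltSum_le_one hS hμ
  have hupper : q * (enormR μ ^ 2 - m ^ 2) ≤ B * m ^ (2 + a) := by
    rw [hBm]; linarith [hmE.1, hmE.2, hμE.1, hμE.2]
  have hreduce : q * |enormR μ ^ 2 - m ^ 2| ≤ B * m ^ (2 + a) →
      |enormR μ - m| ≤ B / K * m ^ a * m := fun hle =>
    abs_sub_le_of_sq_sub_sq (enormR_nonneg μ) hm hJ.K_pos
      ((mul_le_mul_of_nonneg_right hq (abs_nonneg _)).trans hle)
  constructor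
  · rcases le_total (enormR μ) m with hle | hle
    · have : 0 ≤ B / K * m ^ a * m := by have := hJ.K_pos; positivity
      linarith
    · refine (le_abs_self _).trans (hreduce ?_)
      rwa [abs_of_nonneg (by nlinarith)]
  · intro hnot
    apply hreduce
    have heq := hJ.tiltSum_eq_one hS ⟨hμ, hnot⟩
    rw [heq] at hμE
    rw [← abs_of_nonneg (hJ.K_pos.le.trans hq), ← abs_mul, abs_le]
    constructor <;> rw [hBm] <;> linarith [hmE.1, hmE.2, hμE.1, hμE.2]

theorem AssumptionJ.abs_normS_sub_le (hJ : AssumptionJ S J h M K ζ) (hS : AssumptionOmega S)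
    (hd : 1 ≤ d) (x : Fin d → ℝ) :
    |normS S x - enormR x| ≤
      M * ((d : ℝ) ^ (2 + min ζ 2) + 1) / K * mass S ^ min ζ 2 * enormR x := by
  have hm := (hS.mass_pos_and_boundary hd).1
  set m := mass S with hmdef
  set E := M * ((d : ℝ) ^ (2 + min ζ 2) + 1) / K * m ^ min ζ 2
  have hupper : ∀ r ∈ (fun μ => rdot μ x) '' closure (Omega S),
      r ≤ (m + E * m) * enormR x := by
    rintro _ ⟨μ, hμ, rfl⟩
    have h1 := (hJ.enormR_estimate hS hd hμ).1
    calc rdot μ x ≤ enormR μ * enormR x := (le_abs_self _).trans (abs_rdot_le μ x)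
      _ ≤ _ := mul_le_mul_of_nonneg_right (by linarith) (enormR_nonneg x)
  have hlower : ∃ r ∈ (fun μ => rdot μ x) '' closure (Omega S),
      (m - E * m) * enormR x ≤ r := by
    rcases eq_or_ne x 0 with rfl | hx
    · exact ⟨_, ⟨0, subset_closure hS.zero_mem, rfl⟩, by simp [rdot, enormR]⟩
    · obtain ⟨t, ht, htx⟩ := hS.exists_boundary_ray hd hx
      refine ⟨_, ⟨t • x, htx.1, rfl⟩, ?_⟩
      have h1 := abs_le.1 ((hJ.enormR_estimate hS hd htx.1).2 htx.2)
      rw [enormR_smul ht.le] at h1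
      simp only [rdot_smul_self]
      calc (m - E * m) * enormR x ≤ (t * enormR x) * enormR x :=
            mul_le_mul_of_nonneg_right (by linarith [h1.1]) (enormR_nonneg x)
        _ = _ := by ring
  obtain ⟨r, hr, hr'⟩ := hlower
  have h1 := csSup_le ⟨r, hr⟩ hupper
  have h2 := hr'.trans (le_csSup ⟨_, hupper⟩ hr)
  rw [normS, ← hmdef, abs_le]
  constructor
  · rw [le_sub_iff_add_le, le_div_iff₀ hm]; linarith
  · rw [sub_le_iff_le_add, div_le_iff₀ hm]; linarith

end Boundary

theorem statement8 (d : ℕ) (hd : 1 ≤ d) (δ zc M K ζ : ℝ)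
    (S J h : ℝ → (Fin d → ℤ) → ℝ)
    (hfam : CriticalFamily d δ zc M K ζ S J h) :
    ∃ C δ' : ℝ, 0 < C ∧ 0 < δ' ∧ δ' ≤ δ ∧
      ∀ z ∈ Set.Ico (zc - δ') zc, ∀ x : Fin d → ℝ,
        |normS (S z) x - enormR x| ≤ C * mass (S z) ^ min ζ 2 * enormR x := by
  have hz : zc - δ ∈ Set.Ico (zc - δ) zc := ⟨le_rfl, by linarith [hfam.δ_pos]⟩
  have hM := (hfam.assumJ _ hz).M_pos
  have hK := (hfam.assumJ _ hz).K_pos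
  exact ⟨M * ((d : ℝ) ^ (2 + min ζ 2) + 1) / K, δ, by positivity, hfam.δ_pos, le_rfl,
    fun z hz x => (hfam.assumJ z hz).abs_normS_sub_le (hfam.assumOmega z hz) hd x⟩

end OZpaper
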